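/- Under the projective Lelieuvre relations in asymptotic coordinates, at every point p ∈ ℝ² one has f·⟨f_{xx},ν_x⟩ = −[ν,ν_x,ν_{xx}], ⟨f_{xx},ν_x⟩² = det(ν,ν_x,ν_{xx},ν_{xxx}), f·⟨f_{yy},ν_y⟩ = [ν,ν_y,ν_{yy}], and ⟨f_{yy},ν_y⟩² = −det(ν,ν_y,ν_{yy},ν_{yyy}). -/

import Mathlib

noncomputable section

/-- Euclidean pairing on `ℝ⁴`. -/
def dot4 (a b : Fin 4 → ℝ) : ℝ := ∑ i, a i * b i

/-- Determinant of the 4×4 matrix with rows `a, b, c, d`. -/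
def det4 (a b c d : Fin 4 → ℝ) : ℝ := Matrix.det (Matrix.of ![a, b, c, d])

/-- Partial derivative in the first (`x`) variable. -/
def dx (g : ℝ × ℝ → Fin 4 → ℝ) : ℝ × ℝ → Fin 4 → ℝ := fun p => fderiv ℝ g p (1, 0)

/-- Partial derivative in the second (`y`) variable. -/
def dy (g : ℝ × ℝ → Fin 4 → ℝ) : ℝ × ℝ → Fin 4 → ℝ := fun p => fderiv ℝ g p (0, 1)

theorem dot4_comm (a b : Fin 4 → ℝ) : dot4 a b = dot4 b a :=
  Finset.sum_congr rfl fun i _ => mul_comm (a i) (b i)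

theorem dot4_single_one (i : Fin 4) (a : Fin 4 → ℝ) : dot4 (Pi.single i 1) a = a i := by
  simp [dot4, Pi.single_apply]

theorem dot4_smul_right (c : ℝ) (a b : Fin 4 → ℝ) : dot4 a (c • b) = c * dot4 a b := by
  simp only [dot4, Pi.smul_apply, smul_eq_mul, Finset.mul_sum]
  exact Finset.sum_congr rfl fun i _ => mul_left_comm _ _ _

theorem dot4_neg_right (a b : Fin 4 → ℝ) : dot4 a (-b) = -dot4 a b := by
  simp [dot4]

/-- A vector is determined by its pairings. -/
theorem eq_of_dot4_eq {a b : Fin 4 → ℝ} (h : ∀ w, dot4 w a = dot4 w b) : a = b := by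
  ext i
  simpa only [dot4_single_one] using h (Pi.single i 1)

theorem det4_eq_zero_of_snd_eq_thd (w a b : Fin 4 → ℝ) : det4 w a a b = 0 :=
  Matrix.det_zero_of_row_eq (i := 1) (j := 2) (by decide) rfl

theorem det4_eq_zero_of_snd_eq_fth (w a b : Fin 4 → ℝ) : det4 w b a b = 0 :=
  Matrix.det_zero_of_row_eq (i := 1) (j := 3) (by decide) rfl

theorem det4_rotate_last (w a b c : Fin 4 → ℝ) : det4 w c a b = det4 w a b c := by
  simp [det4, Matrix.det_succ_row_zero, Fin.sum_univ_succ, Fin.succAbove]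
  ring

theorem det4_rotate (a b c d : Fin 4 → ℝ) : det4 a b c d = -det4 d a b c := by
  simp [det4, Matrix.det_succ_row_zero, Fin.sum_univ_succ, Fin.succAbove]
  ring

/-- The derivative of `g` in the direction `v`. -/
def dirDeriv (v : ℝ × ℝ) (g : ℝ × ℝ → Fin 4 → ℝ) : ℝ × ℝ → Fin 4 → ℝ :=
  fun p => fderiv ℝ g p v

theorem contDiff_dirDeriv (v : ℝ × ℝ) {g : ℝ × ℝ → Fin 4 → ℝ}
    (hg : ContDiff ℝ (⊤ : ℕ∞) g) : ContDiff ℝ (⊤ : ℕ∞) (dirDeriv v g) :=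
  (hg.fderiv_right (m := (⊤ : ℕ∞)) (by simp)).clm_apply contDiff_const

/-- Leibniz rule for two everywhere orthogonal maps. -/
theorem dot4_dirDeriv_add_eq_zero (v : ℝ × ℝ) {g h : ℝ × ℝ → Fin 4 → ℝ}
    (hg : ContDiff ℝ (⊤ : ℕ∞) g) (hh : ContDiff ℝ (⊤ : ℕ∞) h)
    (hgh : ∀ p, dot4 (g p) (h p) = 0) (p : ℝ × ℝ) :
    dot4 (dirDeriv v g p) (h p) + dot4 (g p) (dirDeriv v h p) = 0 := by
  have hg' := hasFDerivAt_pi'.1 (hg.differentiable (by simp) p).hasFDerivAt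
  have hh' := hasFDerivAt_pi'.1 (hh.differentiable (by simp) p).hasFDerivAt
  have hsum := HasFDerivAt.fun_sum (u := Finset.univ) fun i _ => (hg' i).mul (hh' i)
  have hzero : HasFDerivAt (fun q => ∑ i, g q i * h q i) (0 : ℝ × ℝ →L[ℝ] ℝ) p :=
    (hasFDerivAt_const (0 : ℝ) p).congr_of_eventuallyEq (.of_forall hgh)
  have key := congrArg (fun L : ℝ × ℝ →L[ℝ] ℝ => L v) (hsum.unique hzero)
  simp only [sum_apply, add_apply,
    smul_apply, ContinuousLinearMap.comp_apply,
    ContinuousLinearMap.proj_apply, smul_eq_mul, zero_apply] at key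
  rw [← key, dot4, dot4, ← Finset.sum_add_distrib]
  refine Finset.sum_congr rfl fun i _ => ?_
  simp only [dirDeriv]
  ring

/-- Consequences of the Lelieuvre relation `f ∧ ∂ᵥf = ε ⋆(ν ∧ ∂ᵥν)` in a single direction `v`. -/
theorem lelieuvre_dirDeriv (v : ℝ × ℝ) (ε : ℝ) {f ν : ℝ × ℝ → Fin 4 → ℝ}
    (hsf : ContDiff ℝ (⊤ : ℕ∞) f) (hsν : ContDiff ℝ (⊤ : ℕ∞) ν)
    (hpair : ∀ p, dot4 (f p) (ν p) = 0)
    (hL : ∀ p, ∀ w z : Fin 4 → ℝ,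
      dot4 w (f p) * dot4 z (dirDeriv v f p) - dot4 z (f p) * dot4 w (dirDeriv v f p)
        = ε * det4 w z (ν p) (dirDeriv v ν p))
    (hf0 : ∀ p, f p ≠ 0) (p : ℝ × ℝ) :
    (∀ w, dot4 (dirDeriv v (dirDeriv v f) p) (dirDeriv v ν p) * dot4 w (f p)
      = -(ε * det4 w (ν p) (dirDeriv v ν p) (dirDeriv v (dirDeriv v ν) p))) ∧
    dot4 (dirDeriv v (dirDeriv v f) p) (dirDeriv v ν p) ^ 2
      = ε * det4 (ν p) (dirDeriv v ν p) (dirDeriv v (dirDeriv v ν) p)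
          (dirDeriv v (dirDeriv v (dirDeriv v ν)) p) := by
  have hsf₁ := contDiff_dirDeriv v hsf
  have hsν₁ := contDiff_dirDeriv v hsν
  have hsν₂ := contDiff_dirDeriv v hsν₁
  have cancel : ∀ q (c : ℝ), (∀ w, dot4 w (f q) * c = 0) → c = 0 := by
    intro q c h
    by_contra hc
    refine hf0 q (funext fun i => ?_)
    simpa [dot4_single_one, hc] using h (Pi.single i 1)
  have hνf₁ : ∀ q, dot4 (ν q) (dirDeriv v f q) = 0 := fun q => cancel q _ fun w => by
    simpa [dot4_comm (ν q) (f q), hpair, det4_eq_zero_of_snd_eq_thd] using hL q w (ν q)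
  have hfν₁ : ∀ q, dot4 (f q) (dirDeriv v ν q) = 0 := fun q => by
    simpa [dot4_comm _ (ν q), hνf₁] using dot4_dirDeriv_add_eq_zero v hsf hsν hpair q
  have hν₁f₁ : ∀ q, dot4 (dirDeriv v f q) (dirDeriv v ν q) = 0 := fun q =>
    cancel q _ fun w => by
      simpa [dot4_comm (dirDeriv v ν q), hfν₁, det4_eq_zero_of_snd_eq_fth]
        using hL q w (dirDeriv v ν q)
  have hfν₂ : ∀ q, dot4 (f q) (dirDeriv v (dirDeriv v ν) q) = 0 := fun q => by
    simpa [hν₁f₁] using dot4_dirDeriv_add_eq_zero v hsf hsν₁ hfν₁ q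
  have hf₂ν₁ := dot4_dirDeriv_add_eq_zero v hsf₁ hsν₁ hν₁f₁ p
  have hfν₃ := dot4_dirDeriv_add_eq_zero v hsf hsν₂ hfν₂ p
  have hdet : ∀ w, dot4 (dirDeriv v (dirDeriv v f) p) (dirDeriv v ν p) * dot4 w (f p)
      = -(ε * det4 w (ν p) (dirDeriv v ν p) (dirDeriv v (dirDeriv v ν) p)) := fun w => by
    have h := hL p w (dirDeriv v (dirDeriv v ν) p)
    rw [dot4_comm (dirDeriv v (dirDeriv v ν) p) (f p), hfν₂, det4_rotate_last,
      dot4_comm (dirDeriv v (dirDeriv v ν) p) (dirDeriv v f p)] at h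
    linear_combination dot4 w (f p) * hf₂ν₁ - h
  refine ⟨hdet, ?_⟩
  have h := hdet (dirDeriv v (dirDeriv v (dirDeriv v ν)) p)
  rw [dot4_comm _ (f p)] at h
  rw [det4_rotate]
  linear_combination h
    + dot4 (dirDeriv v (dirDeriv v f) p) (dirDeriv v ν p) * (hf₂ν₁ - hfν₃)

theorem stmt3 (f ν : ℝ × ℝ → Fin 4 → ℝ)
    (hsf : ContDiff ℝ (⊤ : ℕ∞) f) (hsν : ContDiff ℝ (⊤ : ℕ∞) ν)
    (hpair : ∀ p, dot4 (f p) (ν p) = 0)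
    (hLx : ∀ p, ∀ w z : Fin 4 → ℝ,
      dot4 w (f p) * dot4 z (dx f p) - dot4 z (f p) * dot4 w (dx f p)
        = det4 w z (ν p) (dx ν p))
    (hLy : ∀ p, ∀ w z : Fin 4 → ℝ,
      dot4 w (f p) * dot4 z (dy f p) - dot4 z (f p) * dot4 w (dy f p)
        = - det4 w z (ν p) (dy ν p))
    (hf0 : ∀ p, f p ≠ 0)
    (tr : (Fin 4 → ℝ) → (Fin 4 → ℝ) → (Fin 4 → ℝ) → (Fin 4 → ℝ))
    (htr : ∀ w a b c : Fin 4 → ℝ, dot4 w (tr a b c) = det4 w a b c) :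
    ∀ p : ℝ × ℝ,
      dot4 (dx (dx f) p) (dx ν p) • f p = - tr (ν p) (dx ν p) (dx (dx ν) p) ∧
      (dot4 (dx (dx f) p) (dx ν p)) ^ 2
        = det4 (ν p) (dx ν p) (dx (dx ν) p) (dx (dx (dx ν)) p) ∧
      dot4 (dy (dy f) p) (dy ν p) • f p = tr (ν p) (dy ν p) (dy (dy ν) p) ∧
      (dot4 (dy (dy f) p) (dy ν p)) ^ 2
        = - det4 (ν p) (dy ν p) (dy (dy ν) p) (dy (dy (dy ν)) p) := by
  intro p
  obtain ⟨hx, hxx⟩ := lelieuvre_dirDeriv (1, 0) 1 hsf hsν hpair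
    (fun q w z => by rw [one_mul]; exact hLx q w z) hf0 p
  obtain ⟨hy, hyy⟩ := lelieuvre_dirDeriv (0, 1) (-1) hsf hsν hpair
    (fun q w z => by rw [neg_one_mul]; exact hLy q w z) hf0 p
  rw [one_mul] at hxx
  rw [neg_one_mul] at hyy
  refine ⟨eq_of_dot4_eq fun w => ?_, hxx, eq_of_dot4_eq fun w => ?_, hyy⟩
  · rw [dot4_smul_right, dot4_neg_right, htr]
    exact (hx w).trans (by rw [one_mul]; rfl)
  · rw [dot4_smul_right, htr]
    exact (hy w).trans (by rw [neg_one_mul, neg_neg]; rfl)
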